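/- arXiv:1602.01202 — 9 statements merged into one kernel-verified Lean document; each statement's English description precedes it below -/
import Mathlib

section
/- Let q be a prime power, n > k ≥ 1, and G0 an n×(n−k) matrix over F_q with column span C0. Fix an information coordinate i ∈ {1,…,k} and an integer r* ≥ 0. Suppose that for all messages m, m' ∈ F_q^k with m'_i ≠ m_i and m'_j = m_j for all j ≠ i, and for every stuck-at value s ∈ F_q, there exist parity vectors p, p' ∈ F_q^{n−k} such that the codewords c = (m,0)+G0·p and c' = (m',0)+G0·p' both satisfy c_i = c'_i = s and ‖c − c'‖ ≤ r*. Then there exists a nonzero codeword c0 ∈ C0 with i ∈ supp(c0) and ‖c0‖ ≤ r* + 1. -/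
open Matrix

/-- Paper's Lemma 1: if information coordinate `i` has information rewriting locality `r`
(every single-coordinate message update at `i` with the cell stuck at any value `s` can be
masked by a pair of codewords agreeing with `s` at `i` and differing in at most `r`
positions), then the additive code `C0` (the column span of `G0`) contains a nonzero
codeword supported on `i` of Hamming weight at most `r + 1`. -/
theorem information_rewriting_locality_gives_low_weight_codeword
    {F : Type*} [Field F] [Fintype F] [DecidableEq F]
    {n k : ℕ} (hk : 1 ≤ k) (hkn : k < n)
    (G0 : Matrix (Fin n) (Fin (n - k)) F)
    (i : Fin n) (hi : (i : ℕ) < k) (r : ℕ)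
    (hloc : ∀ m m' : Fin k → F,
      m' ⟨i, hi⟩ ≠ m ⟨i, hi⟩ →
      (∀ j : Fin k, j ≠ ⟨i, hi⟩ → m' j = m j) →
      ∀ s : F, ∃ p p' : Fin (n - k) → F,
        ((fun j : Fin n => if h : (j : ℕ) < k then m ⟨j, h⟩ else 0) + G0.mulVec p) i = s ∧
        ((fun j : Fin n => if h : (j : ℕ) < k then m' ⟨j, h⟩ else 0) + G0.mulVec p') i = s ∧
        hammingNorm
          (((fun j : Fin n => if h : (j : ℕ) < k then m ⟨j, h⟩ else 0) + G0.mulVec p) -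
           ((fun j : Fin n => if h : (j : ℕ) < k then m' ⟨j, h⟩ else 0) + G0.mulVec p')) ≤ r) :
    ∃ p0 : Fin (n - k) → F,
      G0.mulVec p0 ≠ 0 ∧ G0.mulVec p0 i ≠ 0 ∧ hammingNorm (G0.mulVec p0) ≤ r + 1 := by
  obtain ⟨p, p', h1, h2, h3⟩ := hloc 0 (Pi.single ⟨i, hi⟩ 1) (by simp)
    (fun j hj => by simp [hj]) 0
  have e1 : G0.mulVec p i = 0 := by simpa using h1
  have e2 : 1 + G0.mulVec p' i = 0 := by simpa [hi] using h2
  have e3 : G0.mulVec (p - p') i = 1 := by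
    rw [Matrix.mulVec_sub, Pi.sub_apply, e1]
    linear_combination -e2
  have e4 : G0.mulVec (p - p') i ≠ 0 := by
    rw [e3]
    exact one_ne_zero
  refine ⟨p - p', fun h => e4 (by rw [h]; rfl), e4, ?_⟩
  refine le_trans ?_ (Nat.add_le_add_right h3 1)
  unfold hammingNorm
  refine le_trans (Finset.card_le_card ?_) (Finset.card_insert_le i _)
  intro j hj
  rw [Finset.mem_insert]
  by_cases hji : j = i
  · exact Or.inl hji
  · right
    have hv : (j : ℕ) ≠ (i : ℕ) := fun h => hji (Fin.ext h)
    simp only [Finset.mem_filter, Finset.mem_univ, true_and] at hj ⊢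
    rw [Matrix.mulVec_sub] at hj
    simpa [Pi.single_apply, hv] using hj
end

section
/- Let q be a prime power, n > k ≥ 1, and G0 an n×(n−k) matrix over F_q with column span C0. Assume the code has rewriting locality r* ≥ 1, i.e., for every coordinate i ∈ {1,…,n} there exists c0 ∈ C0 with i ∈ supp(c0) and ‖c0‖ ≤ r* + 1. Then for all messages m, m' ∈ F_q^k and every single stuck-at defect, given by a coordinate i ∈ {1,…,n} and stuck-at value s ∈ F_q, there exist parity vectors p, p' ∈ F_q^{n−k} such that c = (m,0)+G0·p and c' = (m',0)+G0·p' both mask the defect (c_i = c'_i = s) and the rewriting cost satisfies ‖c − c'‖ ≤ ‖m − m'‖ + r* − 1. -/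
open Matrix

theorem norm_sub_aux {F : Type*} [Field F] [DecidableEq F] {n : ℕ} (e c : Fin n → F) (i : Fin n)
    (r : ℕ) (hr : 1 ≤ r) (hc : c i ≠ 0) (hw : hammingNorm c ≤ r + 1) :
    hammingNorm (e - (e i / c i) • c) ≤ hammingNorm e + r - 1 := by
  by_cases he : e i = 0
  · simp only [he, zero_div, zero_smul, sub_zero]
    omega
  · unfold hammingNorm at *
    set A := Finset.univ.filter (fun j => e j ≠ 0) with hA
    set B := Finset.univ.filter (fun j => c j ≠ 0) with hB
    have hiA : i ∈ A := by simp [hA, he]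
    have hiB : i ∈ B := by simp [hB, hc]
    have hsub : Finset.univ.filter (fun j => (e - (e i / c i) • c) j ≠ 0)
        ⊆ A.erase i ∪ B.erase i := by
      intro j hj
      have hj' : e j - e i / c i * c j ≠ 0 := by simpa using hj
      have hji : j ≠ i := by
        rintro rfl
        apply hj'
        field_simp
        simp
      by_cases h1 : e j = 0
      · have h2 : c j ≠ 0 := by
          intro h2
          apply hj'
          simp [h1, h2]
        simp [hB, hji, h2]
      · simp [hA, hji, h1]
    have h3 := Finset.card_le_card hsub
    have h4 := Finset.card_union_le (A.erase i) (B.erase i)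
    have h5 := Finset.card_erase_add_one hiA
    have h6 := Finset.card_erase_add_one hiB
    omega

theorem norm_ext_aux {F : Type*} [Field F] [DecidableEq F] {n k : ℕ} (hkn : k < n)
    (m m' : Fin k → F) :
    hammingNorm ((fun j : Fin n => if h : (j : ℕ) < k then m ⟨j, h⟩ else 0) -
      (fun j : Fin n => if h : (j : ℕ) < k then m' ⟨j, h⟩ else 0)) ≤ hammingDist m m' := by
  unfold hammingNorm hammingDist
  rw [← Finset.card_map (Fin.castLEEmb hkn.le)]
  apply Finset.card_le_card
  intro j hj
  simp only [Finset.mem_filter, Finset.mem_univ, true_and, Pi.sub_apply] at hj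
  by_cases h : (j : ℕ) < k
  · simp only [h, dite_true] at hj
    simp only [Finset.mem_map, Finset.mem_filter, Finset.mem_univ, true_and]
    exact ⟨⟨j, h⟩, sub_ne_zero.mp hj, rfl⟩
  · simp [h] at hj

/-- Paper's Theorem 1: for an LWC with rewriting locality `r` (every coordinate lies in the
support of a codeword of the additive code `C0 = colspan G0` of weight at most `r + 1`),
any update from message `m` to `m'` in the presence of a single stuck-at defect `(i, s)`
can be performed with rewriting cost `‖c - c'‖ ≤ ‖m - m'‖ + r - 1`, where both codewords
mask the defect. -/
theorem rewriting_cost_bound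
    {F : Type*} [Field F] [Fintype F] [DecidableEq F]
    {n k : ℕ} (hk : 1 ≤ k) (hkn : k < n)
    (G0 : Matrix (Fin n) (Fin (n - k)) F) (r : ℕ) (hr : 1 ≤ r)
    (hloc : ∀ i : Fin n, ∃ p0 : Fin (n - k) → F,
      G0.mulVec p0 i ≠ 0 ∧ hammingNorm (G0.mulVec p0) ≤ r + 1) :
    ∀ (m m' : Fin k → F) (i : Fin n) (s : F),
    ∃ p p' : Fin (n - k) → F,
      ((fun j : Fin n => if h : (j : ℕ) < k then m ⟨j, h⟩ else 0) + G0.mulVec p) i = s ∧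
      ((fun j : Fin n => if h : (j : ℕ) < k then m' ⟨j, h⟩ else 0) + G0.mulVec p') i = s ∧
      hammingNorm
        (((fun j : Fin n => if h : (j : ℕ) < k then m ⟨j, h⟩ else 0) + G0.mulVec p) -
         ((fun j : Fin n => if h : (j : ℕ) < k then m' ⟨j, h⟩ else 0) + G0.mulVec p'))
        ≤ hammingDist m m' + r - 1 := by
  intro m m' i s
  obtain ⟨p0, h0, hw⟩ := hloc i
  have hd := norm_ext_aux hkn m m'
  generalize (fun j : Fin n => if h : (j : ℕ) < k then m ⟨j, h⟩ else 0) = M at *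
  generalize (fun j : Fin n => if h : (j : ℕ) < k then m' ⟨j, h⟩ else 0) = M' at *
  have hn := norm_sub_aux (M - M') (G0.mulVec p0) i r hr h0 hw
  refine ⟨((s - M i) / G0.mulVec p0 i) • p0, ((s - M' i) / G0.mulVec p0 i) • p0, ?_, ?_, ?_⟩
  · simp [Matrix.mulVec_smul, h0]
  · simp [Matrix.mulVec_smul, h0]
  · have : (M + G0.mulVec (((s - M i) / G0.mulVec p0 i) • p0)) -
        (M' + G0.mulVec (((s - M' i) / G0.mulVec p0 i) • p0)) =
        (M - M') - ((M - M') i / G0.mulVec p0 i) • G0.mulVec p0 := by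
      ext j
      simp only [Matrix.mulVec_smul, Pi.add_apply, Pi.sub_apply, Pi.smul_apply, smul_eq_mul]
      ring
    rw [this]
    omega
end

section
/- Let q be a prime power, n > k ≥ 1, and G0 an n×(n−k) matrix over F_q with column span C0. Assume the code has rewriting locality r* ≥ 1, i.e., for every coordinate i ∈ {1,…,n} there exists c0 ∈ C0 with i ∈ supp(c0) and ‖c0‖ ≤ r* + 1. Then for every message m ∈ F_q^k and every single stuck-at defect, given by a coordinate i ∈ {1,…,n} and stuck-at value s ∈ F_q, there exists p ∈ F_q^{n−k} such that c = (m,0)+G0·p masks the defect (c_i = s) and the initial writing cost satisfies ‖c‖ − w ≤ ‖m‖ + r*, where w = 1 if s ≠ 0 and w = 0 if s = 0. -/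
open Matrix

/-- Paper's Corollary 1: for an LWC with rewriting locality `r`, any message `m` can be
stored in the initial (all-zero) stage of `n` cells containing a single stuck-at defect
`(i, s)` by a codeword `c` masking the defect with initial writing cost
`‖c‖ - w ≤ ‖m‖ + r`, where `w = 1` if `s ≠ 0` and `w = 0` if `s = 0`. -/
theorem initial_writing_cost_bound
    {F : Type*} [Field F] [Fintype F] [DecidableEq F]
    {n k : ℕ} (hk : 1 ≤ k) (hkn : k < n)
    (G0 : Matrix (Fin n) (Fin (n - k)) F) (r : ℕ) (hr : 1 ≤ r)
    (hloc : ∀ i : Fin n, ∃ p0 : Fin (n - k) → F,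
      G0.mulVec p0 i ≠ 0 ∧ hammingNorm (G0.mulVec p0) ≤ r + 1) :
    ∀ (m : Fin k → F) (i : Fin n) (s : F),
    ∃ p : Fin (n - k) → F,
      ((fun j : Fin n => if h : (j : ℕ) < k then m ⟨j, h⟩ else 0) + G0.mulVec p) i = s ∧
      hammingNorm ((fun j : Fin n => if h : (j : ℕ) < k then m ⟨j, h⟩ else 0) + G0.mulVec p)
        - (if s ≠ 0 then 1 else 0)
        ≤ hammingNorm m + r := by
  intro m i s
  set M : Fin n → F := fun j : Fin n => if h : (j : ℕ) < k then m ⟨j, h⟩ else 0 with hM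
  have hMm : hammingNorm M ≤ hammingNorm m := by
    unfold hammingNorm
    refine le_trans (Finset.card_le_card (t := (Finset.univ.filter (fun j => m j ≠ 0)).image
      (Fin.castLE hkn.le)) ?_) Finset.card_image_le
    intro j hj
    rw [Finset.mem_filter] at hj
    have hj2 := hj.2
    simp only [hM] at hj2
    by_cases h : (j : ℕ) < k
    · rw [dif_pos h] at hj2
      exact Finset.mem_image.2 ⟨⟨j, h⟩, by simpa using hj2, by ext; rfl⟩
    · rw [dif_neg h] at hj2
      exact absurd rfl hj2
  obtain ⟨p0, hp, hw⟩ := hloc i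
  by_cases hz : s = 0 ∧ M i = 0
  · refine ⟨0, by simp [hz.1, hz.2], ?_⟩
    simp only [Matrix.mulVec_zero, add_zero]
    omega
  set t : F := (s - M i) / G0.mulVec p0 i with ht
  have hc : (M + G0.mulVec (t • p0)) i = s := by
    rw [Matrix.mulVec_smul]
    simp only [Pi.add_apply, Pi.smul_apply, smul_eq_mul, ht]
    field_simp
    ring
  refine ⟨t • p0, hc, ?_⟩
  have hsub : Finset.univ.filter (fun j => (M + G0.mulVec (t • p0)) j ≠ 0) ⊆
      Finset.univ.filter (fun j => M j ≠ 0) ∪ Finset.univ.filter (fun j => G0.mulVec p0 j ≠ 0) := by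
    intro j hj
    simp only [Finset.mem_union, Finset.mem_filter, Finset.mem_univ, true_and] at hj ⊢
    by_contra! hcon
    apply hj
    rw [Matrix.mulVec_smul]
    simp [hcon.1, hcon.2]
  have hun := Finset.card_union_le (Finset.univ.filter (fun j => M j ≠ 0))
    (Finset.univ.filter (fun j => G0.mulVec p0 j ≠ 0))
  unfold hammingNorm at hMm hw ⊢
  by_cases hs : s = 0
  · have hlt := Finset.card_lt_card (Finset.ssubset_iff_subset_ne.2 ⟨hsub, fun he => by
      have hi : i ∈ Finset.univ.filter (fun j => (M + G0.mulVec (t • p0)) j ≠ 0) := by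
        rw [he]; simp [hp]
      rw [Finset.mem_filter] at hi
      exact hi.2 (hc.trans hs)⟩)
    rw [if_neg (by simpa using hs)]
    omega
  · have hle := Finset.card_le_card hsub
    rw [if_pos hs]
    omega
end

section
/- Let q be a prime power and let C ⊆ F_q^n be a cyclic linear code with 0 ≠ C ≠ F_q^n, minimum distance d = min{‖c‖ : c ∈ C, c ≠ 0}, and dual code C^⊥ with minimum distance d^⊥ = min{‖x‖ : x ∈ C^⊥, x ≠ 0}. Construct the LWC by taking C0 = C^⊥ (equivalently, a generator matrix G0 of the LWC equal to a parity-check matrix of C). Then: (1) the LWC minimum distance d* = min{‖x‖ : x ≠ 0 and ⟨x, c0⟩ = 0 for all c0 ∈ C0} equals d; and (2) for every coordinate i ∈ {1,…,n}, min{‖c0‖ : c0 ∈ C0, c0_i ≠ 0} = d^⊥, so the rewriting locality is r* = d^⊥ − 1. Hence the constructed cyclic LWC has parameters (d*, r*) = (d, d^⊥ − 1). -/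
open scoped Fin.CommRing Fin.NatCast in
theorem lwc_aux_shift {F : Type*} [Field F] {n : ℕ} [NeZero n]
    (C : Submodule F (Fin n → F))
    (hcyc : ∀ c ∈ C, (fun i : Fin n => c (i - 1)) ∈ C)
    (x : Fin n → F) (hx : ∀ c ∈ C, ∑ j, x j * c j = 0) (a : Fin n) :
    ∀ c ∈ C, ∑ j, x (j + a) * c j = 0 := by
  have key : ∀ k : ℕ, ∀ c ∈ C, ∑ j, x (j + (k : Fin n)) * c j = 0 := by
    intro k
    induction k with
    | zero => simpa using hx
    | succ k ih =>
      intro c hc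
      rw [← ih _ (hcyc c hc)]
      refine Fintype.sum_equiv (Equiv.addRight (1 : Fin n)) _ _ ?_
      intro j
      have e1 : j + ((k + 1 : ℕ) : Fin n) = j + 1 + (k : Fin n) := by push_cast; ring
      rw [e1]
      simp
  have := key a.val
  simpa using this

theorem lwc_aux_norm {F : Type*} [Field F] [DecidableEq F] {n : ℕ} [NeZero n]
    (x : Fin n → F) (a : Fin n) :
    hammingNorm (fun j => x (j + a)) = hammingNorm x := by
  unfold hammingNorm
  refine Finset.card_equiv (Equiv.addRight a) ?_
  intro i
  simp

theorem lwc_aux_dd {F : Type*} [Field F] {n : ℕ}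
    (C : Submodule F (Fin n → F)) (x : Fin n → F)
    (hx : ∀ c0 : Fin n → F, (∀ c ∈ C, ∑ j, c0 j * c j = 0) → ∑ j, x j * c0 j = 0) :
    x ∈ C := by
  by_contra hn
  obtain ⟨f, hf, hC⟩ := Submodule.exists_le_ker_of_notMem hn
  have e : ∀ v : Fin n → F, f v = ∑ j, v j * f (Pi.single j 1) := by
    intro v
    have := LinearMap.pi_apply_eq_sum_univ f v
    rw [this]
    refine Finset.sum_congr rfl fun j _ => ?_
    rw [smul_eq_mul]
    congr 2
    ext t
    simp [Pi.single_apply, eq_comm]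
  apply hf
  rw [e]
  apply hx
  intro c hc
  have := hC hc
  rw [LinearMap.mem_ker, e] at this
  rw [← this]
  exact Finset.sum_congr rfl fun j _ => mul_comm _ _

/-- Paper's Theorem 2 (duality of LRC and LWC): let `C ⊆ F_q^n` be a cyclic linear code,
`0 ≠ C ≠ F_q^n`, with minimum distance `d` and dual minimum distance `dperp`. Take the
additive code of the LWC to be `C0 = C^⊥` (so a generator matrix of the LWC is a
parity-check matrix of `C`). Then the LWC minimum distance
`d* = min {‖x‖ : x ≠ 0, x ⊥ C0}` equals `d`, for every coordinate `i` the minimum weight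
of a codeword of `C0` supported on `i` equals `dperp`, and the rewriting locality is
exactly `r* = dperp - 1`. -/
theorem cyclic_lwc_from_cyclic_code_parameters
    {F : Type*} [Field F] [Fintype F] [DecidableEq F]
    {n : ℕ} [NeZero n]
    (C : Submodule F (Fin n → F)) (hCbot : C ≠ ⊥) (hCtop : C ≠ ⊤)
    (hcyc : ∀ c ∈ C, (fun i : Fin n => c (i - 1)) ∈ C)
    (d dperp : ℕ)
    (hd : IsLeast {w | ∃ c ∈ C, c ≠ 0 ∧ hammingNorm c = w} d)
    (hdp : IsLeast {w | ∃ x : Fin n → F,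
      (∀ c ∈ C, ∑ j, x j * c j = 0) ∧ x ≠ 0 ∧ hammingNorm x = w} dperp) :
    IsLeast {w | ∃ x : Fin n → F, x ≠ 0 ∧
      (∀ c0 : Fin n → F, (∀ c ∈ C, ∑ j, c0 j * c j = 0) → ∑ j, x j * c0 j = 0) ∧
      hammingNorm x = w} d ∧
    (∀ i : Fin n, IsLeast {w | ∃ c0 : Fin n → F,
      (∀ c ∈ C, ∑ j, c0 j * c j = 0) ∧ c0 i ≠ 0 ∧ hammingNorm c0 = w} dperp) ∧
    IsLeast {r | ∀ i : Fin n, ∃ c0 : Fin n → F,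
      (∀ c ∈ C, ∑ j, c0 j * c j = 0) ∧ c0 i ≠ 0 ∧ hammingNorm c0 ≤ r + 1} (dperp - 1) := by
  have A : ∀ i : Fin n, IsLeast {w | ∃ c0 : Fin n → F,
      (∀ c ∈ C, ∑ j, c0 j * c j = 0) ∧ c0 i ≠ 0 ∧ hammingNorm c0 = w} dperp := by
    intro i
    constructor
    · obtain ⟨x, hx, hx0, hw⟩ := hdp.1
      obtain ⟨j, hj⟩ := Function.ne_iff.1 hx0
      refine ⟨fun t => x (t + (j - i)), lwc_aux_shift C hcyc x hx _, ?_, ?_⟩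
      · simpa using hj
      · rw [lwc_aux_norm, hw]
    · rintro w ⟨x, hx, hi, hw⟩
      exact hdp.2 ⟨x, hx, fun h => hi (by simp [h]), hw⟩
  refine ⟨⟨?_, ?_⟩, A, ?_, ?_⟩
  · obtain ⟨c, hc, hc0, hw⟩ := hd.1
    refine ⟨c, hc0, fun c0 h0 => ?_, hw⟩
    rw [← h0 c hc]
    exact Finset.sum_congr rfl fun j _ => mul_comm _ _
  · rintro w ⟨x, hx0, hx, hw⟩
    exact hd.2 ⟨x, lwc_aux_dd C x hx, hx0, hw⟩
  · intro i
    obtain ⟨x, hx, hi, hw⟩ := (A i).1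
    exact ⟨x, hx, hi, by omega⟩
  · intro r hr
    obtain ⟨x, hx, hi, hw⟩ := hr 0
    have := (A 0).2 ⟨x, hx, hi, rfl⟩
    omega
end

section
/- Let q be a prime power and C ⊆ F_q^n a cyclic linear code of dimension k with 0 < k < n, minimum distance d, and dual minimum distance d^⊥ ≥ 2. Suppose C is an optimal cyclic locally repairable code with locality r = d^⊥ − 1, i.e., d = n − k − ⌈k / (d^⊥ − 1)⌉ + 2. Then the cyclic LWC obtained by taking C0 = C^⊥ is optimal: its minimum distance d* = min{‖x‖ : x ≠ 0, x ⊥ C0} and rewriting locality r* (the least integer such that every coordinate lies in the support of a codeword of C0 of weight at most r* + 1) satisfy d* = n − k − ⌈k / r*⌉ + 2 with r* = d^⊥ − 1. -/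
open scoped Fin.CommRing in
lemma shift_all {F : Type*} [Field F] {n : ℕ} [NeZero n]
    (C : Submodule F (Fin n → F))
    (hcyc : ∀ c ∈ C, (fun i : Fin n => c (i - 1)) ∈ C) (t : Fin n) :
    ∀ c ∈ C, (fun i : Fin n => c (i - t)) ∈ C := by
  have h : ∀ m : ℕ, ∀ c ∈ C, (fun i : Fin n => c (i - (m : Fin n))) ∈ C := by
    intro m
    induction m with
    | zero => intro c hc; simpa using hc
    | succ m ih =>
      intro c hc
      have h1 := hcyc _ (ih c hc)
      convert h1 using 3
      push_cast
      ring
  have := h t.val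
  rwa [Fin.cast_val_eq_self] at this

lemma double_dual {F : Type*} [Field F] {n : ℕ}
    (C : Submodule F (Fin n → F)) (x : Fin n → F) :
    (∀ c0 : Fin n → F, (∀ c ∈ C, ∑ j, c0 j * c j = 0) → ∑ j, x j * c0 j = 0) ↔ x ∈ C := by
  constructor
  · intro h
    by_contra hx
    obtain ⟨f, hf, hfC⟩ := Submodule.exists_le_ker_of_notMem hx
    have key : ∀ v : Fin n → F, f v = ∑ j, v j * f (Pi.single j 1) := by
      intro v
      rw [LinearMap.pi_apply_eq_sum_univ f v]
      refine Finset.sum_congr rfl fun j _ => ?_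
      rw [smul_eq_mul]
      congr 2
      ext i
      simp [Pi.single_apply, eq_comm]
    apply hf
    rw [key]
    apply h
    intro c hc
    have := hfC hc
    rw [LinearMap.mem_ker, key] at this
    simpa [mul_comm] using this
  · intro hx c0 h
    simpa [mul_comm] using h x hx

/-- Paper's Remark 1 (optimal cyclic LWC from optimal cyclic LRC): let `C ⊆ F_q^n` be a
cyclic linear code of dimension `k`, `0 < k < n`, minimum distance `d`, dual minimum
distance `dperp ≥ 2`, which is an optimal cyclic LRC with locality `r = dperp - 1`, i.e.
`d = n - k - ⌈k / (dperp - 1)⌉ + 2`. Then the cyclic LWC built on `C0 = C^⊥` is optimal: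
its minimum distance `d*` and rewriting locality `r*` satisfy `r* = dperp - 1` and
`d* = n - k - ⌈k / r*⌉ + 2`. -/
theorem optimal_cyclic_lwc_from_optimal_cyclic_lrc
    {F : Type*} [Field F] [Fintype F] [DecidableEq F]
    {n k : ℕ} [NeZero n] (hk : 0 < k) (hkn : k < n)
    (C : Submodule F (Fin n → F))
    (hdim : Module.finrank F C = k)
    (hcyc : ∀ c ∈ C, (fun i : Fin n => c (i - 1)) ∈ C)
    (d dperp : ℕ) (hdperp : 2 ≤ dperp)
    (hd : IsLeast {w | ∃ c ∈ C, c ≠ 0 ∧ hammingNorm c = w} d)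
    (hdp : IsLeast {w | ∃ x : Fin n → F,
      (∀ c ∈ C, ∑ j, x j * c j = 0) ∧ x ≠ 0 ∧ hammingNorm x = w} dperp)
    (hopt : (d : ℤ) = (n : ℤ) - (k : ℤ) - ⌈(k : ℚ) / ((dperp : ℚ) - 1)⌉ + 2)
    (dstar rstar : ℕ)
    (hdstar : IsLeast {w | ∃ x : Fin n → F, x ≠ 0 ∧
      (∀ c0 : Fin n → F, (∀ c ∈ C, ∑ j, c0 j * c j = 0) → ∑ j, x j * c0 j = 0) ∧
      hammingNorm x = w} dstar)
    (hrstar : IsLeast {r | ∀ i : Fin n, ∃ c0 : Fin n → F,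
      (∀ c ∈ C, ∑ j, c0 j * c j = 0) ∧ c0 i ≠ 0 ∧ hammingNorm c0 ≤ r + 1} rstar) :
    rstar = dperp - 1 ∧
    (dstar : ℤ) = (n : ℤ) - (k : ℤ) - ⌈(k : ℚ) / (rstar : ℚ)⌉ + 2 := by
  have hr : rstar = dperp - 1 := by
    refine hrstar.unique ⟨?_, ?_⟩
    · obtain ⟨⟨x, hx, hx0, hxw⟩, -⟩ := hdp
      obtain ⟨j0, hj0⟩ := Function.ne_iff.1 hx0
      intro i
      refine ⟨fun j => x (j - (i - j0)), ?_, ?_, ?_⟩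
      · intro c hc
        have h1 := hx _ (shift_all C hcyc (-(i - j0)) c hc)
        rw [← h1, ← Equiv.sum_comp (Equiv.subRight (i - j0))
          (fun j => x j * c (j - -(i - j0)))]
        refine Finset.sum_congr rfl fun j _ => ?_
        simp only [Equiv.subRight_apply, sub_neg_eq_add, sub_add_cancel]
      · simpa using hj0
      · have : hammingNorm (fun j => x (j - (i - j0))) = hammingNorm x := by
          unfold hammingNorm
          refine Finset.card_equiv (Equiv.subRight (i - j0)) ?_
          simp
        rw [this, hxw]
        omega
    · intro r hr
      obtain ⟨c0, h1, h2, h3⟩ := hr 0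
      have := hdp.2 ⟨c0, h1, fun h => h2 (by simp [h]), rfl⟩
      omega
  have hds : dstar = d := by
    refine hdstar.unique ⟨?_, ?_⟩
    · obtain ⟨⟨c, hc, hc0, hw⟩, -⟩ := hd
      exact ⟨c, hc0, (double_dual C c).2 hc, hw⟩
    · rintro w ⟨x, hx0, hx, hw⟩
      exact hd.2 ⟨x, (double_dual C x).1 hx, hx0, hw⟩
  refine ⟨hr, ?_⟩
  rw [hds, hopt, hr, Nat.cast_sub (by omega)]
  simp
end

section
/- Let q be a prime power, n > k ≥ 1, and G0 an n×(n−k) matrix over F_q of rank n−k with column span C0. Suppose the code has rewriting locality r* ≥ 1, i.e., for every coordinate i ∈ {1,…,n} there exists c0 ∈ C0 with i ∈ supp(c0) and ‖c0‖ ≤ r* + 1. Let d* = min{‖x‖ : x ∈ F_q^n, x ≠ 0, G0^T x = 0}. Then d* ≤ n − k − ⌈k / r*⌉ + 2. -/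
open Matrix

/-- The subspace of `D` vanishing on `S`. -/
def lwcVan {F : Type*} [Field F] {n : ℕ} (D : Submodule F (Fin n → F)) (S : Finset (Fin n)) :
    Submodule F (Fin n → F) where
  carrier := {x | x ∈ D ∧ ∀ i ∈ S, x i = 0}
  add_mem' := by
    rintro a b ⟨ha, ha'⟩ ⟨hb, hb'⟩
    exact ⟨D.add_mem ha hb, fun i hi => by simp [ha' i hi, hb' i hi]⟩
  zero_mem' := ⟨D.zero_mem, fun i _ => rfl⟩
  smul_mem' := by
    rintro c a ⟨ha, ha'⟩
    exact ⟨D.smul_mem c ha, fun i hi => by simp [ha' i hi]⟩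

lemma mem_lwcVan {F : Type*} [Field F] {n : ℕ} {D : Submodule F (Fin n → F)}
    {S : Finset (Fin n)} {x : Fin n → F} :
    x ∈ lwcVan D S ↔ x ∈ D ∧ ∀ i ∈ S, x i = 0 := Iff.rfl

lemma lwcVan_insert {F : Type*} [Field F] {n : ℕ} (D : Submodule F (Fin n → F))
    (S : Finset (Fin n)) (a : Fin n) :
    Module.finrank F (lwcVan D S) ≤ Module.finrank F (lwcVan D (insert a S)) + 1 := by
  let p : (Fin n → F) →ₗ[F] F := LinearMap.proj a
  have h1 : lwcVan D (insert a S) = lwcVan D S ⊓ LinearMap.ker p := by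
    ext x
    simp only [Submodule.mem_inf, mem_lwcVan, LinearMap.mem_ker, Finset.mem_insert,
      forall_eq_or_imp, p, LinearMap.proj_apply]
    tauto
  have h2 := Submodule.finrank_sup_add_finrank_inf_eq (lwcVan D S) (LinearMap.ker p)
  have h3 := LinearMap.finrank_range_add_finrank_ker p
  have h4 := Submodule.finrank_le (LinearMap.range p)
  have h5 := Submodule.finrank_le (lwcVan D S ⊔ LinearMap.ker p)
  rw [Module.finrank_self] at h4
  rw [h1]
  omega

lemma lwcVan_union {F : Type*} [Field F] {n : ℕ} (D : Submodule F (Fin n → F))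
    (S T : Finset (Fin n)) :
    Module.finrank F (lwcVan D S) ≤ Module.finrank F (lwcVan D (T ∪ S)) + T.card := by
  induction T using Finset.induction_on with
  | empty => rw [Finset.empty_union]; simp
  | insert a T ha ih =>
    have := lwcVan_insert D (T ∪ S) a
    rw [Finset.insert_union, Finset.card_insert_of_notMem ha]
    omega

lemma lwcVan_exists {F : Type*} [Field F] {n : ℕ} (D : Submodule F (Fin n → F))
    (S : Finset (Fin n)) (h : 0 < Module.finrank F (lwcVan D S)) :
    ∃ x ∈ lwcVan D S, x ≠ 0 ∧ ∃ i, i ∉ S ∧ x i ≠ 0 := by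
  have hne : lwcVan D S ≠ ⊥ := by
    intro h0
    rw [h0, finrank_bot] at h
    exact lt_irrefl _ h
  obtain ⟨x, hx, hx0⟩ := Submodule.exists_mem_ne_zero_of_ne_bot hne
  obtain ⟨i, hi⟩ := Function.ne_iff.mp hx0
  exact ⟨x, hx, hx0, i, fun hS => hi (hx.2 i hS), hi⟩

lemma lwcVan_extend {F : Type*} [Field F] {n : ℕ} (D : Submodule F (Fin n → F))
    (m : ℕ) : ∀ S : Finset (Fin n), m + 1 ≤ Module.finrank F (lwcVan D S) →
      ∃ S' : Finset (Fin n), S'.card = S.card + m ∧ 0 < Module.finrank F (lwcVan D S') := by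
  induction m with
  | zero => exact fun S h => ⟨S, rfl, by omega⟩
  | succ m ih =>
    intro S h
    obtain ⟨x, -, -, i, hi, -⟩ := lwcVan_exists D S (by omega)
    have := lwcVan_insert D S i
    obtain ⟨S', h1, h2⟩ := ih (insert i S) (by omega)
    refine ⟨S', ?_, h2⟩
    rw [h1, Finset.card_insert_of_notMem hi]
    omega

lemma lwcVan_greedy {F : Type*} [Field F] [DecidableEq F] {n : ℕ} (D : Submodule F (Fin n → F))
    (r t : ℕ) (ht : t * r < Module.finrank F D)
    (hloc : ∀ i : Fin n, ∃ c : Fin n → F, (∀ x ∈ D, c ⬝ᵥ x = 0) ∧ c i ≠ 0 ∧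
      hammingNorm c ≤ r + 1) :
    ∀ j ≤ t, ∃ S : Finset (Fin n), S.card ≤ j * (r + 1) ∧
      Module.finrank F D + j ≤ Module.finrank F (lwcVan D S) + S.card := by
  intro j
  induction j with
  | zero =>
    intro _
    refine ⟨∅, by simp, ?_⟩
    have : lwcVan D ∅ = D := by ext x; simp [mem_lwcVan]
    rw [this]
    simp
  | succ j ih =>
    intro hj
    obtain ⟨S, h1, h2⟩ := ih (by omega)
    have h3 : j * r ≤ t * r := Nat.mul_le_mul_right r (by omega)
    have h4 : j * (r + 1) = j * r + j := by ring
    have h4' : (j + 1) * (r + 1) = j * (r + 1) + (r + 1) := by ring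
    obtain ⟨-, -, -, i, hi, -⟩ := lwcVan_exists D S (by omega)
    obtain ⟨c, hc, hci, hcr⟩ := hloc i
    let C : Finset (Fin n) := Finset.univ.filter (fun i => c i ≠ 0)
    have hCc : C.card ≤ r + 1 := hcr
    have hiC : i ∈ C := by simp [C, hci]
    let T := (C \ S).erase i
    have hiCS : i ∈ C \ S := Finset.mem_sdiff.mpr ⟨hiC, hi⟩
    have hT : T.card + 1 = (C \ S).card := Finset.card_erase_add_one hiCS
    have hU : (C \ S).card + S.card = (C ∪ S).card := by
      rw [Finset.card_sdiff_add_card]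
    have hCS : (C \ S).card ≤ C.card := Finset.card_le_card Finset.sdiff_subset
    have h5 := lwcVan_union D S T
    have hle : lwcVan D (T ∪ S) ≤ lwcVan D (C ∪ S) := by
      rintro x ⟨hxD, hx⟩
      have hne : ∀ l ∈ C ∪ S, l ≠ i → x l = 0 := by
        intro l hl hli
        apply hx
        simp only [T, Finset.mem_union, Finset.mem_erase, Finset.mem_sdiff] at hl ⊢
        tauto
      refine ⟨hxD, fun l hl => ?_⟩
      by_cases hli : l = i
      · subst hli
        have h0 := hc x hxD
        unfold dotProduct at h0
        rw [Finset.sum_eq_single l] at h0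
        · exact (mul_eq_zero.mp h0).resolve_left hci
        · intro b _ hb
          by_cases hbC : c b = 0
          · simp [hbC]
          · rw [hne b (by simp [C, hbC]) hb, mul_zero]
        · simp
      · exact hne l hl hli
    have h6 := Submodule.finrank_mono hle
    exact ⟨C ∪ S, by omega, by omega⟩

theorem lwc_singleton_type_bound
    {F : Type*} [Field F] [Fintype F] [DecidableEq F]
    {n k : ℕ} (hk : 1 ≤ k) (hkn : k < n)
    (G0 : Matrix (Fin n) (Fin (n - k)) F) (hrank : G0.rank = n - k)
    (r : ℕ) (hr : 1 ≤ r)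
    (hloc : ∀ i : Fin n, ∃ p0 : Fin (n - k) → F,
      G0.mulVec p0 i ≠ 0 ∧ hammingNorm (G0.mulVec p0) ≤ r + 1)
    (dstar : ℕ)
    (hdstar : IsLeast {w | ∃ x : Fin n → F,
      x ≠ 0 ∧ G0ᵀ.mulVec x = 0 ∧ hammingNorm x = w} dstar) :
    (dstar : ℤ) ≤ (n : ℤ) - (k : ℤ) - ⌈(k : ℚ) / (r : ℚ)⌉ + 2 := by
  let D : Submodule F (Fin n → F) := LinearMap.ker G0ᵀ.mulVecLin
  have hD : Module.finrank F D = k := by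
    have h1 := LinearMap.finrank_range_add_finrank_ker G0ᵀ.mulVecLin
    have h2 : Module.finrank F (LinearMap.range G0ᵀ.mulVecLin) = n - k := by
      exact (Matrix.rank_transpose G0).trans hrank
    rw [h2, Module.finrank_fin_fun] at h1
    change n - k + Module.finrank F D = n at h1
    omega
  have hmem : ∀ x, x ∈ D ↔ G0ᵀ.mulVec x = 0 := fun x => Iff.rfl
  let t := (k - 1) / r
  have ht : t * r < k := by
    have : t * r ≤ k - 1 := Nat.div_mul_le_self (k - 1) r
    omega
  have hceil : ⌈(k : ℚ) / (r : ℚ)⌉ ≤ (t : ℤ) + 1 := by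
    rw [Int.ceil_le, div_le_iff₀ (by exact_mod_cast hr)]
    have h : k - 1 < r * ((k - 1) / r + 1) := Nat.lt_mul_div_succ (k - 1) (by omega)
    have h' : k ≤ (t + 1) * r := by
      rw [mul_comm]
      show k ≤ r * ((k - 1) / r + 1)
      omega
    exact_mod_cast h'
  obtain ⟨S, hS1, hS2⟩ := lwcVan_greedy D r t (by omega) (by
    intro i
    obtain ⟨p, hp1, hp2⟩ := hloc i
    refine ⟨G0.mulVec p, fun x hx => ?_, hp1, hp2⟩
    rw [hmem] at hx
    rw [dotProduct_comm, Matrix.dotProduct_mulVec, ← Matrix.mulVec_transpose, hx,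
      zero_dotProduct]) t le_rfl
  have h4 : t * (r + 1) = t * r + t := by ring
  obtain ⟨S', h1, h2⟩ := lwcVan_extend D (Module.finrank F (lwcVan D S) - 1) S (by omega)
  obtain ⟨x, hx, hx0, -⟩ := lwcVan_exists D S' h2
  have hd : dstar ≤ hammingNorm x := hdstar.2 ⟨x, hx0, (hmem x).1 hx.1, rfl⟩
  have hw : hammingNorm x + S'.card ≤ n := by
    have hdis : Disjoint (Finset.univ.filter (fun i => x i ≠ 0)) S' := by
      rw [Finset.disjoint_left]
      intro i hi hiS
      exact (Finset.mem_filter.mp hi).2 (hx.2 i hiS)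
    have := Finset.card_le_univ (Finset.univ.filter (fun i => x i ≠ 0) ∪ S')
    rw [Finset.card_union_of_disjoint hdis, Fintype.card_fin] at this
    exact this
  omega
end

section
/- Let n ≥ 4 be even and k = n − 2. Define the embedding π : F_2^{n−2} → F_2^n placing m_1,…,m_{n/2−1} in coordinates 1,…,n/2−1, a zero in coordinate n/2, m_{n/2},…,m_{n−2} in coordinates n/2+1,…,n−1, and a zero in coordinate n; and let G0 ∈ F_2^{n×2} have first column equal to 1 on coordinates 1,…,n/2 and 0 elsewhere, and second column equal to 1 on coordinates n/2+1,…,n and 0 elsewhere. Then for all messages m, m' ∈ F_2^{n−2} differing in exactly one coordinate and every single stuck-at defect given by i ∈ {1,…,n} and s ∈ F_2, there exist p, p' ∈ F_2^2 such that c = π(m) + G0·p and c' = π(m') + G0·p' satisfy c_i = c'_i = s and ‖c − c'‖ ≤ n/2 − 1. -/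
open Matrix

/-- The embedding of the paper's toy example (equation (9)): the message
`m ∈ F_2^{n-2}` is placed in coordinates `1, …, n/2 - 1` and `n/2 + 1, …, n - 1`
(1-indexed), with parity positions (zeros) at coordinates `n/2` and `n`. -/
def toyEmbed (n : ℕ) (m : Fin (n - 2) → ZMod 2) : Fin n → ZMod 2 := fun j =>
  if h : (j : ℕ) < n / 2 - 1 then m ⟨(j : ℕ), by omega⟩
  else if h2 : (j : ℕ) = n / 2 - 1 then 0
  else if h3 : (j : ℕ) < n - 1 then m ⟨(j : ℕ) - 1, by omega⟩
  else 0

theorem toy_aux_card {n : ℕ} (S : Finset (Fin n)) (i : Fin n) (lo hi : ℕ)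
    (hi1 : lo ≤ i) (hi2 : (i : ℕ) < hi) (h : ∀ j ∈ S, j ≠ i ∧ lo ≤ (j : ℕ) ∧ (j : ℕ) < hi) :
    S.card ≤ hi - lo - 1 := by
  have h1 : S.card ≤ ((Finset.Ico lo hi).erase (i : ℕ)).card := by
    apply Finset.card_le_card_of_injOn (fun j : Fin n => (j : ℕ))
    · intro j hj
      have := h j hj
      simp only [Finset.coe_erase, Finset.coe_Ico, Set.mem_diff, Set.mem_Ico,
        Set.mem_singleton_iff]
      exact ⟨this.2, fun e => this.1 (Fin.ext e)⟩
    · intro a _ b _ e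
      exact Fin.ext e
  rw [Finset.card_erase_of_mem (by simp [hi1, hi2]), Nat.card_Ico] at h1
  exact h1

theorem toy_aux_z : ∀ a b : ZMod 2, a ≠ b → a = b + 1 := by decide

/-- Paper's toy example, equation (9): for even `n ≥ 4` and `k = n - 2`, with the two-parity
generator `G0 = [1_{n/2}, 0; 0, 1_{n/2}]`, any single-coordinate message update in the
presence of any single stuck-at defect `(i, s)` can be performed by codewords masking the
defect with rewriting cost at most `n/2 - 1` (instead of `n - 1`). -/
theorem toy_lwc_rewriting_cost
    {n : ℕ} (hn : 4 ≤ n) (heven : Even n)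
    (G0 : Matrix (Fin n) (Fin 2) (ZMod 2))
    (hG0 : ∀ (j : Fin n) (l : Fin 2),
      G0 j l = if l = 0 then (if (j : ℕ) < n / 2 then 1 else 0)
               else (if n / 2 ≤ (j : ℕ) then 1 else 0)) :
    ∀ m m' : Fin (n - 2) → ZMod 2,
    (∃ i0 : Fin (n - 2), m' i0 ≠ m i0 ∧ ∀ j : Fin (n - 2), j ≠ i0 → m' j = m j) →
    ∀ (i : Fin n) (s : ZMod 2),
    ∃ p p' : Fin 2 → ZMod 2,
      (toyEmbed n m + G0.mulVec p) i = s ∧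
      (toyEmbed n m' + G0.mulVec p') i = s ∧
      hammingDist (toyEmbed n m + G0.mulVec p) (toyEmbed n m' + G0.mulVec p')
        ≤ n / 2 - 1 := by
  intro m m' ⟨i0, hne, heq⟩ i s
  have hmul : ∀ (p : Fin 2 → ZMod 2) (j : Fin n),
      (G0.mulVec p) j = if (j : ℕ) < n / 2 then p 0 else p 1 := by
    intro p j
    simp only [Matrix.mulVec, dotProduct, Fin.sum_univ_two, hG0]
    by_cases hj : (j : ℕ) < n / 2
    · simp [hj]
    · simp [hj, not_lt.mp hj]
  obtain ⟨t, ht⟩ := heven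
  obtain ⟨e0, he⟩ : ∃ e0 : Fin n, ∀ j : Fin n, j ≠ e0 → toyEmbed n m' j = toyEmbed n m j := by
    refine ⟨⟨if (i0 : ℕ) < n / 2 - 1 then i0 else i0 + 1, by split_ifs <;> omega⟩, ?_⟩
    intro j hj
    have hj' : (j : ℕ) ≠ if (i0 : ℕ) < n / 2 - 1 then (i0 : ℕ) else i0 + 1 :=
      fun e => hj (Fin.ext e)
    unfold toyEmbed
    split_ifs with h1 h2 h3
    · apply heq
      intro e
      have e' : (j : ℕ) = i0 := congrArg Fin.val e
      split_ifs at hj' <;> omega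
    · rfl
    · apply heq
      intro e
      have e' : (j : ℕ) - 1 = i0 := congrArg Fin.val e
      split_ifs at hj' <;> omega
    · rfl
  by_cases hi : toyEmbed n m' i = toyEmbed n m i
  · refine ⟨fun _ => s - toyEmbed n m i, fun _ => s - toyEmbed n m i, ?_, ?_, ?_⟩
    · simp [hmul]
    · simp [hmul, hi]
    · refine le_trans (b := 1) ?_ (by omega)
      unfold hammingDist
      rw [← Finset.card_singleton e0]
      apply Finset.card_le_card
      intro j hj
      rw [Finset.mem_singleton]
      by_contra hc
      simp [he j hc] at hj
  · have hie : i = e0 := by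
      by_contra hc
      exact hi (he i hc)
    have hz := toy_aux_z _ _ hi
    by_cases hl : (i : ℕ) < n / 2
    · refine ⟨fun _ => s - toyEmbed n m i,
        fun l => if l = 0 then s - toyEmbed n m' i else s - toyEmbed n m i, ?_, ?_, ?_⟩
      · simp [hmul]
      · simp [hmul, hl]
      · refine toy_aux_card _ i 0 (n / 2) (by omega) hl ?_
        intro j hj
        simp only [Finset.mem_filter, Finset.mem_univ, true_and, Pi.add_apply, hmul] at hj
        have hji : j ≠ i := by
          rintro rfl
          simp [hl] at hj
        refine ⟨hji, by omega, ?_⟩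
        by_contra hc
        simp [hc, he j (hie ▸ hji)] at hj
    · refine ⟨fun _ => s - toyEmbed n m i,
        fun l => if l = 0 then s - toyEmbed n m i else s - toyEmbed n m' i, ?_, ?_, ?_⟩
      · simp [hmul]
      · simp [hmul, hl]
      · refine le_trans (toy_aux_card _ i (n / 2) n (by omega) i.2 ?_) (by omega)
        intro j hj
        simp only [Finset.mem_filter, Finset.mem_univ, true_and, Pi.add_apply, hmul] at hj
        have hji : j ≠ i := by
          rintro rfl
          simp [hl] at hj
        refine ⟨hji, ?_, j.2⟩
        by_contra hc
        simp [not_le.mp hc, he j (hie ▸ hji)] at hj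
end

section
/- Let n ≥ 1 and 0 ≤ t ≤ n. Let M be an index set and (C_m)_{m ∈ M} a family of pairwise disjoint subsets of F_2^n such that for every set T ⊆ {1,…,n} with |T| = t, every assignment s : T → F_2, and every m ∈ M, there exists x ∈ C_m with x_j = s(j) for all j ∈ T. Then |M| ≤ 2^{n−t}. -/
/-- Paper's equation (8), right-hand inequality (Kuznetsov–Tsybakov upper bound): if each
message `m` in an index set `M` is represented by a set `C m` of binary codewords of length
`n`, the sets `C m` are pairwise disjoint (unambiguous decoding), and every pattern of `t`
stuck-at defects (positions `T`, `|T| = t`, stuck-at values `s`) can be masked by some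
codeword of every `C m`, then the number of messages satisfies `|M| ≤ 2^(n - t)`. -/
theorem kuznetsov_tsybakov_upper_bound
    {n t : ℕ} (ht : t ≤ n)
    {M : Type*} [Fintype M]
    (C : M → Set (Fin n → ZMod 2))
    (hdisj : ∀ m₁ m₂ : M, m₁ ≠ m₂ → Disjoint (C m₁) (C m₂))
    (hmask : ∀ T : Finset (Fin n), T.card = t →
      ∀ s : Fin n → ZMod 2, ∀ m : M, ∃ x ∈ C m, ∀ j ∈ T, x j = s j) :
    Fintype.card M ≤ 2 ^ (n - t) := by
  obtain ⟨T, -, hT⟩ := Finset.exists_subset_card_eq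
    (s := (Finset.univ : Finset (Fin n))) (n := t) (by simpa using ht)
  choose x hxC hx using hmask T hT 0
  let f : M → ({j : Fin n // j ∈ Tᶜ} → ZMod 2) := fun m j => x m j
  have hf : Function.Injective f := by
    intro a b hab
    by_contra hne
    have hxe : x a = x b := by
      funext j
      by_cases hj : j ∈ T
      · rw [hx a j hj, hx b j hj]
      · exact congrFun hab ⟨j, Finset.mem_compl.mpr hj⟩
    exact Set.disjoint_left.mp (hdisj a b hne) (hxC a) (hxe ▸ hxC b)
  have h := Fintype.card_le_of_injective f hf
  rw [Fintype.card_fun, Fintype.card_coe, Finset.card_compl, hT, ZMod.card, Fintype.card_fin] at h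
  exact h
end

section
/- Let q be a prime power, n > k ≥ 1, d* ≥ 1, and G0 an n×(n−k) matrix over F_q such that every nonzero x ∈ F_q^n with G0^T x = 0 has Hamming weight ‖x‖ ≥ d* (equivalently, any d* − 1 rows of G0 are linearly independent). Then additive encoding masks any d* − 1 stuck-at defects: for every message m ∈ F_q^k, every set T ⊆ {1,…,n} with |T| ≤ d* − 1, and every assignment of stuck-at values s : T → F_q, there exists p ∈ F_q^{n−k} such that the codeword c = (m, 0) + G0·p satisfies c_j = s(j) for all j ∈ T. -/
open Matrix

/-- Additive encoding masks up to `d* - 1` stuck-at defects (Tsybakov; Heegard): if every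
nonzero `x` with `G0ᵀ x = 0` has Hamming weight at least `d*` (equivalently, any `d* - 1`
rows of `G0` are linearly independent), then for every message `m`, every set `T` of at
most `d* - 1` cell positions and every assignment `s` of stuck-at values on `T`, there is a
parity vector `p` such that the codeword `c = (m, 0) + G0 p` agrees with `s` on `T`. -/
theorem additive_encoding_masks_defects
    {F : Type*} [Field F] [Fintype F] [DecidableEq F]
    {n k : ℕ} (hk : 1 ≤ k) (hkn : k < n)
    (dstar : ℕ) (hdstar : 1 ≤ dstar)
    (G0 : Matrix (Fin n) (Fin (n - k)) F)
    (hdist : ∀ x : Fin n → F, x ≠ 0 → G0ᵀ.mulVec x = 0 → dstar ≤ hammingNorm x) :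
    ∀ (m : Fin k → F) (T : Finset (Fin n)), T.card ≤ dstar - 1 →
    ∀ s : Fin n → F,
    ∃ p : Fin (n - k) → F,
      ∀ j ∈ T,
        ((fun j' : Fin n => if h : (j' : ℕ) < k then m ⟨j', h⟩ else 0) + G0.mulVec p) j
          = s j := by
  intro m T hT s
  have hli : LinearIndependent F (G0.submatrix (fun t : T => (t : Fin n)) id).row := by
    rw [Fintype.linearIndependent_iff]
    intro g hg
    by_contra hne
    push Not at hne
    obtain ⟨i, hi⟩ := hne
    let x : Fin n → F := fun j => if h : j ∈ T then g ⟨j, h⟩ else 0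
    have hx : x ≠ 0 := by
      intro h0
      apply hi
      have := congrFun h0 i
      simpa [x] using this
    have hker : G0ᵀ.mulVec x = 0 := by
      funext c
      have h1 := congrFun hg c
      simp only [Finset.sum_apply, Pi.smul_apply, Matrix.row, Matrix.submatrix_apply, id,
        smul_eq_mul, Pi.zero_apply] at h1
      simp only [Matrix.mulVec, dotProduct, Matrix.transpose_apply, Pi.zero_apply]
      rw [← h1, ← Finset.sum_subset (Finset.subset_univ T), ← Finset.sum_coe_sort T]
      · refine Finset.sum_congr rfl fun t _ => ?_
        simp [x, mul_comm]
      · intro j _ hj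
        simp [x, hj]
    have h2 := hdist x hx hker
    have h3 : hammingNorm x ≤ T.card := by
      unfold hammingNorm
      apply Finset.card_le_card
      intro j hj
      by_contra hjT
      simp [x, hjT] at hj
    omega
  have hrank := hli.rank_matrix
  have hsurj : LinearMap.range (G0.submatrix (fun t : T => (t : Fin n)) id).mulVecLin = ⊤ := by
    apply Submodule.eq_top_of_finrank_eq
    rw [Module.finrank_fintype_fun_eq_card]
    exact hrank
  obtain ⟨p, hp⟩ := LinearMap.range_eq_top.mp hsurj (fun t : T =>
    s t - (if h : ((t : Fin n) : ℕ) < k then m ⟨(t : Fin n), h⟩ else 0))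
  refine ⟨p, fun j hj => ?_⟩
  have h4 : G0.mulVec p j = s j - (if h : (j : ℕ) < k then m ⟨j, h⟩ else 0) :=
    congrFun hp ⟨j, hj⟩
  rw [Pi.add_apply, h4]
  exact add_sub_cancel _ _
end
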